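/- Let P be a field, n ≥ 1, and let G be a subgroup of GL_n(P). Then the subgroup H of G generated by all nil-elements of G is a normal subgroup of G and H is locally nilpotent; in particular, the set of nil-elements of G is contained in a locally nilpotent normal subgroup of G. -/

import Mathlib

/-- Engel words with the convention of the paper: the commutator is
`[x, y] = x⁻¹ * y⁻¹ * x * y`, `engelWord 0 x y = x` and
`engelWord (n+1) x y = [engelWord n x y, y]`; thus for `n ≥ 1`,
`engelWord n x y` is the Engel word `e_n(x, y)`. -/
def engelWord {G : Type*} [Group G] : ℕ → G → G → G
  | 0, x, _ => x
  | n + 1, x, y => (engelWord n x y)⁻¹ * y⁻¹ * engelWord n x y * y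

/-- Iterated Engel words: `epsEngel [(n₁,a₁),…,(n_k,a_k)] y` is
`ε_{(n₁,…,n_k)}(a₁,…,a_k; y)`, defined by `ε_{(n₁)}(a₁;y) = e_{n₁}(a₁,y)` and
`ε_{(n₁,…,n_k)}(a₁,…,a_k;y) = e_{n_k}(a_k, ε_{(n₁,…,n_{k-1})}(a₁,…,a_{k-1};y))`. -/
def epsEngel {G : Type*} [Group G] (l : List (ℕ × G)) (y : G) : G :=
  l.foldl (fun z p => engelWord p.1 p.2 z) y

/-- `g` is a nil-element if for every `a` there is `n ≥ 1` with `e_n(a, g) = 1`. -/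
def IsNilElement {G : Type*} [Group G] (g : G) : Prop :=
  ∀ a : G, ∃ n, 1 ≤ n ∧ engelWord n a g = 1

/-- A group is locally nilpotent if every finitely generated subgroup is nilpotent. -/
def LocallyNilpotent (G : Type*) [Group G] : Prop :=
  ∀ H : Subgroup G, H.FG → Group.IsNilpotent H

/-- `g` is quasi-nil of order ≤ `k`: there are functions `ν i : G^(i+1) → ℕ` (with values ≥ 1,
`ν i` depending only on `a₁,…,a_{i+1}` and `g`) such that for all `a : Fin k → G`,
`ε_{(ν₁(a₁),…,ν_k(a₁,…,a_k))}(a₁,…,a_k; g) = 1`. -/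
def IsQuasiNilOfOrder {G : Type*} [Group G] (k : ℕ) (g : G) : Prop :=
  ∃ ν : ∀ i : Fin k, (Fin ((i : ℕ) + 1) → G) → ℕ,
    (∀ i f, 1 ≤ ν i f) ∧
    ∀ a : Fin k → G,
      epsEngel (List.ofFn fun i : Fin k =>
        (ν i fun j => a (Fin.castLE i.isLt j), a i)) g = 1

/-- `g` is quasi-nil if it is quasi-nil of order ≤ `k` for some `k ≥ 1`. -/
def IsQuasiNil {G : Type*} [Group G] (g : G) : Prop :=
  ∃ k, 1 ≤ k ∧ IsQuasiNilOfOrder k g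

/-- `g` maps to a nil-element of the quotient `G ⧸ N` (for `N` normal). -/
def IsNilElementQuot {G : Type*} [Group G] (N : Subgroup G) (hN : N.Normal) (g : G) : Prop :=
  @IsNilElement (G ⧸ N) (@QuotientGroup.Quotient.group G _ N hN) (QuotientGroup.mk g)

theorem map_engelWord {G G' : Type*} [Group G] [Group G'] (f : G →* G') (n : ℕ) (x y : G) :
    f (engelWord n x y) = engelWord n (f x) (f y) := by
  induction n with
  | zero => rfl
  | succ n ih => simp [engelWord, ih]

namespace IsNilElement

variable {G G' : Type*} [Group G] [Group G']

theorem map {g : G} (hg : IsNilElement g) (f : G →* G') (hf : Function.Surjective f) :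
    IsNilElement (f g) := by
  intro a
  obtain ⟨a, rfl⟩ := hf a
  obtain ⟨n, hn, h⟩ := hg a
  exact ⟨n, hn, by rw [← map_engelWord, h, map_one]⟩

theorem of_map {g : G} (f : G →* G') (hf : Function.Injective f) (hg : IsNilElement (f g)) :
    IsNilElement g := by
  intro a
  obtain ⟨n, hn, h⟩ := hg (f a)
  exact ⟨n, hn, hf (by rw [map_engelWord, h, map_one])⟩

theorem conj {g : G} (hg : IsNilElement g) (x : G) : IsNilElement (x * g * x⁻¹) := by
  simpa using hg.map (MulAut.conj x).toMonoidHom (MulAut.conj x).surjective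

theorem exists_engelWord_eq_one {g : G} (hg : IsNilElement g) (a : G) :
    ∃ n, engelWord n a g = 1 :=
  (hg a).imp fun _ h => h.2

end IsNilElement

namespace Subgroup

open scoped commutatorElement

variable {G : Type*} [Group G]

theorem mem_upperCentralSeries_succ_of_closure {S : Set G} (hS : closure S = ⊤) {i : ℕ} {y : G}
    (h : ∀ x ∈ S, ⁅y, x⁆ ∈ upperCentralSeries G i) : y ∈ upperCentralSeries G (i + 1) := by
  have key : ∀ x : G, ⁅y, x⁆ ∈ upperCentralSeries G i ↔
      (QuotientGroup.mk' (upperCentralSeries G i) x) ∈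
        centralizer {QuotientGroup.mk' (upperCentralSeries G i) y} := by
    intro x
    rw [mem_centralizer_singleton_iff, ← QuotientGroup.eq_one_iff]
    change QuotientGroup.mk' _ ⁅y, x⁆ = 1 ↔ _
    rw [map_commutatorElement, commutatorElement_eq_one_iff_mul_comm, eq_comm]
  rw [mem_upperCentralSeries_succ_iff]
  intro x
  rw [key, ← mem_comap]
  have : closure S ≤ (centralizer {QuotientGroup.mk' (upperCentralSeries G i) y}).comap
      (QuotientGroup.mk' (upperCentralSeries G i)) := by
    rw [closure_le]
    intro x hx
    exact (key x).1 (h x hx)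
  exact this (hS ▸ mem_top x)

end Subgroup

section Finite

open Subgroup

variable {G : Type*} [Group G]

/-- A nil-element normalizing a nontrivial nilpotent subgroup centralizes a nontrivial
central element of it. -/
theorem IsNilElement.exists_central_commute {U : Subgroup G} [Group.IsNilpotent U]
    (hU : U ≠ ⊥) {t : G} (ht : IsNilElement t) (htU : t ∈ normalizer (U : Set G)) :
    ∃ z ∈ U, z ≠ 1 ∧ (∀ u ∈ U, z * u = u * z) ∧ z * t = t * z := by
  have : Nontrivial U := (nontrivial_iff_ne_bot U).2 hU
  obtain ⟨a, ha, ha1⟩ := (bot_or_exists_ne_one (center U)).resolve_left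
    (Group.IsNilpotent.center_ne_bot (G := U))
  have hmem : ∀ n, engelWord n (a : G) t ∈ (center U).map U.subtype := by
    have hconj : ∀ w ∈ (center U).map U.subtype, t⁻¹ * w * t ∈ (center U).map U.subtype := by
      rintro _ ⟨w, hw, rfl⟩
      have h1 : t⁻¹ * (w : G) * t ∈ U := by
        simpa using (mem_normalizer_iff.1 (inv_mem htU) w).1 w.2
      refine ⟨⟨_, h1⟩, ?_, rfl⟩
      rw [SetLike.mem_coe, mem_center_iff] at hw ⊢
      intro u
      have h2 : t * (u : G) * t⁻¹ ∈ U := (mem_normalizer_iff.1 htU u).1 u.2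
      have h3 := congrArg Subtype.val (hw ⟨_, h2⟩)
      ext
      simp only [coe_mul] at h3 ⊢
      calc (u : G) * (t⁻¹ * w * t) = t⁻¹ * (t * u * t⁻¹ * w) * t := by group
        _ = t⁻¹ * w * t * u := by rw [h3]; group
    intro n
    induction n with
    | zero => exact ⟨a, ha, rfl⟩
    | succ n ih =>
      have : engelWord (n + 1) (a : G) t
          = (engelWord n (a : G) t)⁻¹ * (t⁻¹ * engelWord n (a : G) t * t) := by
        simp [engelWord, mul_assoc]
      rw [this]
      exact mul_mem (inv_mem ih) (hconj _ ih)
  classical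
  have hex := ht.exists_engelWord_eq_one (a : G)
  have hpos : Nat.find hex ≠ 0 := fun h0 => by
    have := Nat.find_spec hex
    rw [h0] at this
    exact ha1 (Subtype.ext this)
  obtain ⟨m, hm⟩ := Nat.exists_eq_succ_of_ne_zero hpos
  have hz : engelWord m (a : G) t ≠ 1 := Nat.find_min hex (hm ▸ Nat.lt_succ_self m)
  have hz1 := Nat.find_spec hex
  rw [hm] at hz1
  obtain ⟨w, hw, hwz⟩ := hmem m
  refine ⟨engelWord m (a : G) t, hwz ▸ w.2, hz, ?_, ?_⟩
  · intro u hu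
    rw [← hwz]
    exact (congrArg Subtype.val (mem_center_iff.1 hw ⟨u, hu⟩)).symm
  · have : t * engelWord m (a : G) t * engelWord (m + 1) (a : G) t
        = engelWord m (a : G) t * t := by
      simp [engelWord, mul_assoc]
    rw [← this, hz1, mul_one]

theorem Group.IsNilpotent.of_sup_closure_nilElement_eq_top [Finite G] {U : Subgroup G}
    (hU : Group.IsNilpotent U) {t : G} (ht : IsNilElement t) (htU : t ∈ normalizer (U : Set G))
    (htop : U ⊔ zpowers t = ⊤) : Group.IsNilpotent G := by
  induction hn : Nat.card G using Nat.strong_induction_on generalizing G with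
  | _ n ih =>
  subst hn
  by_cases hbot : U = ⊥
  · subst hbot
    rw [bot_sup_eq] at htop
    have : IsCyclic G := ⟨t, fun x => mem_zpowers_iff.1 (by rw [htop]; exact mem_top x)⟩
    let := IsCyclic.commGroup (α := G)
    infer_instance
  · obtain ⟨z, -, hz1, hzU, hzt⟩ := ht.exists_central_commute hbot htU
    have hz : z ∈ center G := by
      rw [← centralizer_univ, ← coe_top, ← htop, mem_centralizer_iff]
      have : U ⊔ zpowers t ≤ centralizer {z} := by
        rw [sup_le_iff, zpowers_le]
        exact ⟨fun u hu => mem_centralizer_singleton_iff.2 (hzU u hu).symm,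
          mem_centralizer_singleton_iff.2 hzt.symm⟩
      exact fun x hx => mem_centralizer_singleton_iff.1 (this hx)
    apply Group.of_quotient_center_nilpotent
    let π := QuotientGroup.mk' (center G)
    have hπ : Function.Surjective π := QuotientGroup.mk'_surjective _
    refine ih (Nat.card (G ⧸ center G)) ?_ (U := U.map π) (t := π t) ?_ (ht.map π hπ) ?_ ?_ rfl
    · rw [card_eq_card_quotient_mul_card_subgroup (center G)]
      refine lt_mul_of_one_lt_right Nat.card_pos ?_
      rw [one_lt_card_iff_ne_bot]
      rintro h
      rw [h, mem_bot] at hz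
      exact hz1 hz
    · exact Group.nilpotent_of_surjective _ (π.subgroupMap_surjective U)
    · exact le_normalizer_map π (mem_map_of_mem π htU)
    · rw [← MonoidHom.map_zpowers, ← Subgroup.map_sup, htop, ← MonoidHom.range_eq_map,
        MonoidHom.range_eq_top.2 hπ]

theorem Group.IsNilpotent.sup_zpowers_nilElement [Finite G] {U : Subgroup G}
    (hU : Group.IsNilpotent U) {t : G} (ht : IsNilElement t) (htU : t ∈ normalizer (U : Set G)) :
    Group.IsNilpotent (U ⊔ zpowers t : Subgroup G) := by
  set W := U ⊔ zpowers t
  have hUW : U ≤ W := le_sup_left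
  have htW : t ∈ W := le_sup_right (a := U) (mem_zpowers t)
  refine Group.IsNilpotent.of_sup_closure_nilElement_eq_top (U := U.subgroupOf W)
    (t := ⟨t, htW⟩) ?_ (ht.of_map W.subtype W.subtype_injective) ?_ ?_
  · exact (Group.isNilpotent_congr (subgroupOfEquivOfLe hUW)).2 hU
  · rw [mem_normalizer_iff] at htU ⊢
    exact fun h => htU h
  · apply map_injective W.subtype_injective
    rw [Subgroup.map_sup, subgroupOf_map_subtype, MonoidHom.map_zpowers, inf_eq_left.2 hUW,
      ← MonoidHom.range_eq_map, range_subtype]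
    rfl

/-- The subgroup is nilpotent and generated by nil-elements of the ambient group. -/
def Subgroup.IsNilGenerated (U : Subgroup G) : Prop :=
  Group.IsNilpotent U ∧ U ≤ closure {g | IsNilElement g ∧ g ∈ U}

theorem Subgroup.IsNilGenerated.map_equiv {U : Subgroup G} (hU : U.IsNilGenerated)
    (e : G ≃* G) : (U.map e.toMonoidHom).IsNilGenerated := by
  refine ⟨(Group.isNilpotent_congr (e.subgroupMap U)).1 hU.1, ?_⟩
  refine (map_mono hU.2).trans ?_
  rw [MonoidHom.map_closure]
  apply closure_mono
  rintro _ ⟨g, ⟨hg, hgU⟩, rfl⟩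
  exact ⟨hg.map e.toMonoidHom e.surjective, mem_map_of_mem _ hgU⟩

theorem Subgroup.IsNilGenerated.maximal_map_conj {U : Subgroup G}
    (hU : Maximal IsNilGenerated U) (x : G) :
    Maximal IsNilGenerated (U.map (MulAut.conj x).toMonoidHom) := by
  refine ⟨hU.1.map_equiv _, fun W hW hUW => ?_⟩
  have h := hU.2 (hW.map_equiv (MulAut.conj x).symm) fun u hu =>
    ⟨_, hUW (mem_map_of_mem _ hu), by simp [mul_assoc]⟩
  intro w hw
  exact ⟨_, h (mem_map_of_mem _ hw), by simp [mul_assoc]⟩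

theorem Subgroup.IsNilGenerated.mem_of_mem_normalizer [Finite G] {U : Subgroup G}
    (hU : Maximal IsNilGenerated U) {t : G} (ht : IsNilElement t)
    (htU : t ∈ normalizer (U : Set G)) : t ∈ U := by
  have htW : t ∈ U ⊔ zpowers t := le_sup_right (a := U) (mem_zpowers t)
  refine hU.2 ⟨hU.1.1.sup_zpowers_nilElement ht htU, ?_⟩ le_sup_left htW
  refine sup_le (hU.1.2.trans (closure_mono fun g hg => ⟨hg.1, le_sup_left (a := U) hg.2⟩)) ?_
  rw [zpowers_le]
  exact subset_closure ⟨ht, htW⟩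

/-- In a finite nilpotent subgroup generated by nil-elements, the subgroup generated by the
nil-elements lying in another subgroup `V` is normalized by a nil-element outside `V`. -/
theorem Subgroup.IsNilGenerated.exists_mem_normalizer [Finite G] {U V : Subgroup G}
    (hU : U.IsNilGenerated) (hUV : ¬ U ≤ V) :
    ∃ u ∈ U, IsNilElement u ∧ u ∉ V ∧
      u ∈ normalizer {g : G | IsNilElement g ∧ g ∈ U ∧ g ∈ V} := by
  let I := closure {g : G | IsNilElement g ∧ g ∈ U ∧ g ∈ V}
  have hI : I ≤ U ⊓ V := (closure_le _).2 fun g hg => hg.2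
  obtain ⟨X, hIX, hX⟩ := (Set.toFinite
    {X : Subgroup G | X ≤ U ∧ ∀ g ∈ X, IsNilElement g → g ∈ V}).exists_le_maximal
      (a := I) ⟨hI.trans inf_le_left, fun g hg _ => (hI hg).2⟩
  have hXU : ¬ U ≤ X := fun h =>
    hUV (hU.2.trans ((closure_le _).2 fun g hg => hX.1.2 g (h hg.2) hg.1))
  have := hU.1
  have hlt : X.subgroupOf U < normalizer (X.subgroupOf U : Set U) :=
    Group.normalizerCondition_of_isNilpotent _ (lt_top_iff_ne_top.2 fun h => hXU (subgroupOf_eq_top.1 h))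
  rw [← subgroupOf_normalizer_eq hX.1.1] at hlt
  obtain ⟨y, hyN, hyX⟩ := SetLike.exists_of_lt hlt
  have hnot : ¬ (normalizer (X : Set G) ⊓ U ≤ U ∧
      ∀ g ∈ normalizer (X : Set G) ⊓ U, IsNilElement g → g ∈ V) := fun h =>
    hyX (hX.2 h (le_inf le_normalizer hX.1.1) ⟨hyN, y.2⟩)
  simp only [inf_le_right, true_and, not_forall] at hnot
  obtain ⟨u, hu, hunil, huV⟩ := hnot
  refine ⟨u, hu.2, hunil, huV, mem_set_normalizer_iff.2 fun h => ?_⟩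
  have hJ : ∀ g : G, (IsNilElement g ∧ g ∈ U ∧ g ∈ V) ↔ IsNilElement g ∧ g ∈ X := fun g =>
    ⟨fun hg => ⟨hg.1, hIX (subset_closure hg)⟩, fun hg => ⟨hg.1, hX.1.1 hg.2, hX.1.2 g hg.2 hg.1⟩⟩
  change (IsNilElement h ∧ h ∈ U ∧ h ∈ V) ↔ (IsNilElement (u * h * u⁻¹) ∧ _ ∧ _)
  rw [hJ, hJ, ← mem_normalizer_iff.1 hu.1 h]
  refine and_congr_left fun _ => ⟨fun hh => hh.conj u, fun hh => ?_⟩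
  simpa [mul_assoc] using hh.conj u⁻¹

theorem Subgroup.IsNilGenerated.eq_of_maximal [Finite G] {U V : Subgroup G}
    (hU : Maximal IsNilGenerated U) (hV : Maximal IsNilGenerated V) : U = V := by
  by_contra hne
  obtain ⟨⟨U, V⟩, ⟨hU, hV, hne⟩, hmax⟩ := Set.Finite.exists_maximalFor
    (fun p : Subgroup G × Subgroup G => {g : G | IsNilElement g ∧ g ∈ p.1 ∧ g ∈ p.2})
    {p | Maximal IsNilGenerated p.1 ∧ Maximal IsNilGenerated p.2 ∧ p.1 ≠ p.2}
    (Set.toFinite _) ⟨(U, V), hU, hV, hne⟩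
  dsimp only at hU hV hne hmax
  set J := {g : G | IsNilElement g ∧ g ∈ U ∧ g ∈ V} with hJ
  obtain ⟨u, huU, hu, huV, huJ⟩ := hU.1.exists_mem_normalizer (V := V)
    fun h => hne (le_antisymm h (hU.2 hV.1 h))
  obtain ⟨v, hvV, hv, hvU, hvJ⟩ := hV.1.exists_mem_normalizer (V := U)
    fun h => hne (le_antisymm (hV.2 hU.1 h) h)
  have hJ' : {g : G | IsNilElement g ∧ g ∈ V ∧ g ∈ U} = J := by
    ext g
    exact and_congr_right fun _ => and_comm
  rw [hJ'] at hvJ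
  have hcJ : ∀ k, engelWord k v u ∈ normalizer J := by
    intro k
    induction k with
    | zero => exact hvJ
    | succ k ih => exact mul_mem (mul_mem (mul_mem (inv_mem ih) (inv_mem huJ)) ih) huJ
  have hstep : ∀ k, engelWord (k + 1) v u ∈ normalizer (U : Set G) →
      engelWord k v u ∈ normalizer (U : Set G) := by
    intro k hk
    set c := engelWord k v u with hc
    have hw : c⁻¹ * u * c = u * (engelWord (k + 1) v u)⁻¹ := by
      simp [engelWord, ← hc, mul_assoc]
    have hwnil : IsNilElement (c⁻¹ * u * c) := by simpa using hu.conj c⁻¹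
    have hwU : c⁻¹ * u * c ∈ U := mem_of_mem_normalizer hU hwnil
      (hw ▸ mul_mem (le_normalizer huU) (inv_mem hk))
    have hwJ : c⁻¹ * u * c ∉ J := fun h =>
      huV ((mem_set_normalizer_iff''.1 (hcJ k) u).2 h).2.2
    by_contra hcU
    have hne' : U ≠ U.map (MulAut.conj c⁻¹).toMonoidHom := fun h =>
      hcU (inv_mem_iff.1 (mem_normalizer_iff_map_conj_eq.2 h.symm))
    have hle := hmax (j := (U, U.map (MulAut.conj c⁻¹).toMonoidHom))
      ⟨hU, maximal_map_conj hU _, hne'⟩ fun g hg => ⟨hg.1, hg.2.1, c * g * c⁻¹,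
        ((mem_set_normalizer_iff.1 (hcJ k) g).1 hg).2.1, by simp [mul_assoc]⟩
    exact hwJ (hle ⟨hwnil, hwU, u, huU, by simp⟩)
  obtain ⟨n, hn⟩ := hu.exists_engelWord_eq_one v
  have hall : ∀ j ≤ n, engelWord (n - j) v u ∈ normalizer (U : Set G) := by
    intro j
    induction j with
    | zero => intro _; rw [Nat.sub_zero, hn]; exact one_mem _
    | succ j ih =>
      intro hj
      apply hstep
      rw [show n - (j + 1) + 1 = n - j by omega]
      exact ih (by omega)
  have hv0 := hall n le_rfl
  rw [Nat.sub_self] at hv0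
  exact hvU (mem_of_mem_normalizer hU hv hv0)

/-- **Baer's theorem**: the nil-elements of a finite group generate a nilpotent subgroup. -/
theorem isNilpotent_closure_nilElements_of_finite [Finite G] :
    Group.IsNilpotent (closure {g : G | IsNilElement g}) := by
  have hexists : ∀ U : Subgroup G, U.IsNilGenerated → ∃ M, U ≤ M ∧ Maximal IsNilGenerated M :=
    fun U hU => (Set.toFinite {U : Subgroup G | U.IsNilGenerated}).exists_le_maximal hU
  obtain ⟨M, -, hM⟩ := hexists ⊥ ⟨inferInstance, bot_le⟩
  have := hM.1.1
  have hle : closure {g : G | IsNilElement g} ≤ M := by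
    rw [closure_le]
    intro t ht
    obtain ⟨W, htW, hW⟩ := hexists (zpowers t) ⟨by
      let := IsCyclic.commGroup (α := zpowers t)
      infer_instance, by
      rw [zpowers_le]
      exact subset_closure ⟨ht, mem_zpowers t⟩⟩
    rw [IsNilGenerated.eq_of_maximal hM hW]
    exact htW (mem_zpowers t)
  exact (Group.isNilpotent_congr (subgroupOfEquivOfLe hle)).1 inferInstance

end Finite

section LinearDerivedLength

open Subgroup Module
open scoped commutatorElement

theorem derivedSeries_succ_le_map_commutator (Q : Type*) [Group Q] (n : ℕ) :
    derivedSeries Q (n + 1) ≤ (derivedSeries (commutator Q) n).map (commutator Q).subtype := by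
  induction n with
  | zero =>
    rw [derivedSeries_one, derivedSeries_zero, ← MonoidHom.range_eq_map, range_subtype]
  | succ n ih =>
    rw [derivedSeries_succ Q (n + 1), derivedSeries_succ (commutator Q) n, map_commutator]
    exact commutator_mono ih ih

/-- The induction step for a group acting on a space with a proper nonzero invariant subspace:
if the `n`-th derived subgroup acts trivially on the subspace and on the quotient, then the next
one acts trivially on the whole space. -/
theorem MonoidHom.map_eq_one_of_mem_derivedSeries_succ {k Q V : Type*} [Field k] [Group Q]
    [AddCommGroup V] [Module k V] (ρ : Q →* End k V) (W : Submodule k V) {n : ℕ}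
    (hW : ∀ g ∈ derivedSeries Q n, ∀ w ∈ W, ρ g w = w)
    (hVW : ∀ g ∈ derivedSeries Q n, ∀ v, ρ g v - v ∈ W)
    {g : Q} (hg : g ∈ derivedSeries Q (n + 1)) : ρ g = 1 := by
  have hle : derivedSeries Q (n + 1) ≤ ρ.ker := by
    rw [derivedSeries_succ, commutator_le]
    have key : ∀ a ∈ derivedSeries Q n, ∀ b ∈ derivedSeries Q n, ∀ v,
        ρ (a * b) v = ρ a v + ρ b v - v := by
      intro a ha b hb v
      have h := hW a ha _ (hVW b hb v)
      rw [map_sub, sub_eq_iff_eq_add] at h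
      rw [map_mul, End.mul_apply, h]
      abel
    intro a ha b hb
    have hab : ρ (a * b) = ρ (b * a) := by
      ext v
      rw [key a ha b hb, key b hb a ha, add_comm (ρ a v)]
    rw [MonoidHom.mem_ker, commutatorElement_def, mul_assoc, ← mul_inv_rev, map_mul, hab,
      ← map_mul, mul_inv_cancel, map_one]
  exact hle hg

/-- The subgroup of elements whose image commutes with a given element. -/
def MonoidHom.commutant {Q M : Type*} [Group Q] [Monoid M] (ρ : Q →* M) (m : M) : Subgroup Q where
  carrier := {g | Commute m (ρ g)}
  one_mem' := by simp
  mul_mem' ha hb := by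
    change Commute m (ρ (_ * _))
    rw [map_mul]
    exact Commute.mul_right ha hb
  inv_mem' {g} hg := by
    have : Commute m (ρ.toHomUnits g : M) := hg
    have h := this.units_inv_right
    rwa [← map_inv] at h

theorem MonoidHom.mem_commutant {Q M : Type*} [Group Q] [Monoid M] {ρ : Q →* M} {m : M} {g : Q} :
    g ∈ ρ.commutant m ↔ Commute m (ρ g) :=
  Iff.rfl

/-- If the image of a nilpotent group is not commutative, then it has a noncentral element all
of whose commutators are central. -/
theorem MonoidHom.exists_not_commute_of_isNilpotent {Q M : Type*} [Group Q] [Group.IsNilpotent Q]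
    [Monoid M] (ρ : Q →* M) (h : ¬ ∀ a b, Commute (ρ a) (ρ b)) :
    ∃ z : Q, (∃ g, ¬ Commute (ρ z) (ρ g)) ∧ ∀ g b, Commute (ρ ⁅z, g⁆) (ρ b) := by
  classical
  have hex : ∃ i, ∃ z ∈ Subgroup.upperCentralSeries Q i, ∃ g, ¬ Commute (ρ z) (ρ g) := by
    obtain ⟨i, hi⟩ := Group.IsNilpotent.nilpotent Q
    push Not at h
    obtain ⟨a, b, hab⟩ := h
    exact ⟨i, a, hi ▸ mem_top a, b, hab⟩
  have hspec := Nat.find_spec hex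
  have hmin : ∀ j < Nat.find hex, _ := fun j hj => Nat.find_min hex hj
  generalize Nat.find hex = i at hspec hmin
  obtain ⟨z, hz, hzg⟩ := hspec
  cases i with
  | zero =>
    obtain ⟨g, hg⟩ := hzg
    rw [Subgroup.upperCentralSeries_zero, mem_bot] at hz
    simp [hz] at hg
  | succ i =>
    refine ⟨z, hzg, fun g b => ?_⟩
    by_contra hc
    exact hmin i i.lt_succ_self ⟨_, Subgroup.mem_upperCentralSeries_succ_iff.1 hz g, b, hc⟩

theorem commutator_le_commutant_of_isScalar {k Q V : Type*} [Field k] [Group Q]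
    [AddCommGroup V] [Module k V] (ρ : Q →* End k V) (z : Q)
    (h : ∀ g, ∃ c : k, ρ ⁅z, g⁆ = c • 1) : commutator Q ≤ ρ.commutant (ρ z) := by
  rw [commutator_def, commutator_le]
  have hc : ∀ g, ∃ c : k, ρ z * ρ g = c • (ρ g * ρ z) := by
    intro g
    obtain ⟨c, hc⟩ := h g
    refine ⟨c, ?_⟩
    have : z * g = ⁅z, g⁆ * (g * z) := by simp [commutatorElement_def, mul_assoc]
    rw [← map_mul, this, map_mul, hc, smul_mul_assoc, one_mul, map_mul]
  intro a _ b _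
  obtain ⟨c, ha⟩ := hc a
  obtain ⟨d, hb⟩ := hc b
  rw [MonoidHom.mem_commutant]
  have hab : ρ z * ρ (a * b) = (c * d) • (ρ (a * b) * ρ z) := by
    rw [map_mul, ← mul_assoc, ha, smul_mul_assoc, mul_assoc, hb, mul_smul_comm, smul_smul,
      mul_assoc]
  have hba : ρ z * ρ (b * a) = (c * d) • (ρ (b * a) * ρ z) := by
    rw [map_mul, ← mul_assoc, hb, smul_mul_assoc, mul_assoc, ha, mul_smul_comm, smul_smul,
      mul_assoc, mul_comm c]
  have hu : ρ (b * a) * ρ (b * a)⁻¹ = 1 := by rw [← map_mul, mul_inv_cancel, map_one]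
  have hcom : a * b = ⁅a, b⁆ * (b * a) := by simp [commutatorElement_def, mul_assoc]
  calc ρ z * ρ ⁅a, b⁆ = ρ z * ρ (a * b) * ρ (b * a)⁻¹ := by
        rw [hcom, map_mul, ← mul_assoc, mul_assoc, hu, mul_one]
    _ = ρ ⁅a, b⁆ * (ρ z * ρ (b * a)) * ρ (b * a)⁻¹ := by
        rw [hab, hba, hcom, map_mul ρ ⁅a, b⁆, mul_smul_comm, mul_assoc (ρ ⁅a, b⁆)]
    _ = ρ ⁅a, b⁆ * ρ z := by rw [mul_assoc, mul_assoc, hu, mul_one]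

universe v

variable {k : Type*} [Field k]

/-- The induction step of `MonoidHom.map_eq_one_of_mem_derivedSeries_of_isNilpotent` for a
representation with a proper nonzero invariant subspace. -/
theorem MonoidHom.map_eq_one_of_mem_derivedSeries_of_invariant {n m : ℕ} {Q : Type*} {V : Type v} [Group Q]
    [AddCommGroup V] [Module k V] [FiniteDimensional k V] (ρ : Q →* End k V)
    (ih : ∀ (V' : Type v) [AddCommGroup V'] [Module k V'] [FiniteDimensional k V']
      (ρ' : Q →* End k V'), finrank k V' ≤ n → ∀ g ∈ derivedSeries Q m, ρ' g = 1)
    (hV : finrank k V ≤ n + 1) {W : Submodule k V} (hW0 : W ≠ ⊥) (hW1 : W ≠ ⊤)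
    (hW : ∀ g, ∀ w ∈ W, ρ g w ∈ W) {g : Q} (hg : g ∈ derivedSeries Q (m + 1)) : ρ g = 1 := by
  refine ρ.map_eq_one_of_mem_derivedSeries_succ W ?_ ?_ hg
  · let σ : Q →* End k W :=
      { toFun := fun g => (ρ g).restrict (hW g)
        map_one' := by ext; simp
        map_mul' := fun a b => by ext; simp }
    have hlt := Submodule.finrank_lt hW1
    intro g hg w hw
    have h := ih W σ (by omega) g hg
    exact congrArg Subtype.val (LinearMap.congr_fun h ⟨w, hw⟩)
  · let σ : Q →* End k (V ⧸ W) :=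
      { toFun := fun g => W.mapQ W (ρ g) (hW g)
        map_one' := by ext; simp
        map_mul' := fun a b => by ext; simp }
    have hadd := W.finrank_quotient_add_finrank
    have hpos : 0 < finrank k W := by
      have := Submodule.nontrivial_iff_ne_bot.2 hW0
      exact finrank_pos
    intro g hg v
    have h := LinearMap.congr_fun (ih (V ⧸ W) σ (by omega) g hg) (Submodule.Quotient.mk v)
    exact (Submodule.Quotient.eq W).1 h

/-- Nilpotent linear groups over an algebraically closed field have derived length bounded by
twice the degree. -/
theorem MonoidHom.map_eq_one_of_mem_derivedSeries_of_isNilpotent [IsAlgClosed k] (n : ℕ)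
    (Q : Type*) [Group Q] [Group.IsNilpotent Q] (V : Type*)
    [AddCommGroup V] [Module k V] [FiniteDimensional k V] (ρ : Q →* End k V)
    (hV : finrank k V ≤ n) (g : Q) (hg : g ∈ derivedSeries Q (2 * n)) : ρ g = 1 := by
  induction n generalizing Q V with
  | zero =>
    have := finrank_zero_iff.1 (Nat.le_zero.1 hV)
    exact Subsingleton.elim _ _
  | succ n ih =>
    by_cases hcomm : ∀ a b, Commute (ρ a) (ρ b)
    · have hle : commutator Q ≤ ρ.ker := by
        rw [commutator_def, commutator_le]
        intro a _ b _
        have hab : ρ (a * b) = ρ (b * a) := by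
          rw [map_mul, map_mul]
          exact hcomm a b
        rw [MonoidHom.mem_ker, commutatorElement_def, mul_assoc, ← mul_inv_rev, map_mul, hab,
          ← map_mul, mul_inv_cancel, map_one]
      exact hle (derivedSeries_one Q ▸ derivedSeries_antitone Q (by omega) hg)
    by_cases hirr : ∃ W : Submodule k V, W ≠ ⊥ ∧ W ≠ ⊤ ∧ ∀ g, ∀ w ∈ W, ρ g w ∈ W
    · obtain ⟨W, hW0, hW1, hW⟩ := hirr
      exact ρ.map_eq_one_of_mem_derivedSeries_of_invariant
        (fun V' _ _ _ ρ' h g hg => ih Q V' ρ' h g hg) hV hW0 hW1 hW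
        (derivedSeries_antitone Q (by omega) hg)
    have hnt : Nontrivial V := by
      by_contra h
      rw [not_nontrivial_iff_subsingleton] at h
      exact hcomm fun a b => Subsingleton.elim _ _
    have heig : ∀ x, ∀ (c : k) (g : Q), Commute (ρ x) (ρ g) →
        ∀ w ∈ (ρ x).eigenspace c, ρ g w ∈ (ρ x).eigenspace c := by
      intro x c g hxg w hw
      rw [End.mem_eigenspace_iff] at hw ⊢
      rw [← End.mul_apply, hxg.eq, End.mul_apply, hw, map_smul]
    have hscalar : ∀ (f : End k V) (c : k), f.eigenspace c = ⊤ → f = c • 1 := by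
      intro f c h
      ext v
      simpa using! End.mem_eigenspace_iff.1 (h ▸ Submodule.mem_top : v ∈ f.eigenspace c)
    obtain ⟨z, ⟨g₀, hg₀⟩, hz⟩ := ρ.exists_not_commute_of_isNilpotent hcomm
    have hQ : commutator Q ≤ ρ.commutant (ρ z) := by
      apply commutator_le_commutant_of_isScalar
      intro g
      obtain ⟨c, hc⟩ := End.exists_eigenvalue (ρ ⁅z, g⁆)
      refine ⟨c, hscalar _ _ ?_⟩
      by_contra htop
      exact hirr ⟨_, hc, htop, fun b => heig _ c b (hz g b)⟩
    obtain ⟨c, hc⟩ := End.exists_eigenvalue (ρ z)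
    obtain ⟨g', hg', rfl⟩ := derivedSeries_succ_le_map_commutator Q (2 * n + 1) hg
    refine (ρ.comp (commutator Q).subtype).map_eq_one_of_mem_derivedSeries_of_invariant
      (fun V' _ _ _ ρ' h g hg => ih (commutator Q) V' ρ' h g hg) hV hc ?_
      (fun b => heig z c b (hQ b.2)) hg'
    intro htop
    apply hg₀
    rw [hscalar _ _ htop]
    exact (Commute.one_left _).smul_left c

end LinearDerivedLength

section Residual

open Subgroup Module

theorem isJacobsonRing_int : IsJacobsonRing ℤ := by
  rw [isJacobsonRing_iff_prime_eq]
  intro I hI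
  by_cases hbot : I = ⊥
  · subst hbot
    rw [eq_bot_iff]
    intro x hx
    have h := Int.isUnit_iff.1 (Ideal.mem_jacobson_bot.1 hx x)
    rw [Ideal.mem_bot]
    rcases h with h | h <;> nlinarith [mul_self_nonneg x]
  · have := hI.isMaximal hbot
    exact Ideal.jacobson_eq_self_of_isMaximal

theorem finite_of_field_of_finiteType_int (K : Type*) [Field K] [Algebra.FiniteType ℤ K] :
    Finite K := by
  have := isJacobsonRing_int
  have : Module.Finite ℤ K := finite_of_finite_type_of_isJacobsonRing ℤ K
  refine Module.finite_of_fg_torsion K ?_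
  have hint : Algebra.IsIntegral ℤ K := Algebra.IsIntegral.of_finite ℤ K
  have hker : ¬ Function.Injective (algebraMap ℤ K) := fun hinj =>
    Int.not_isField (isField_of_isIntegral_of_isField hinj (Field.toIsField K))
  rw [injective_iff_map_eq_zero] at hker
  push Not at hker
  obtain ⟨m, hm, hm0⟩ := hker
  intro x
  refine ⟨⟨m, mem_nonZeroDivisors_of_ne_zero hm0⟩, ?_⟩
  change m • x = 0
  rw [Algebra.smul_def, hm, zero_mul]

theorem Matrix.GeneralLinearGroup.map_injective {m R S : Type*} [DecidableEq m] [Fintype m]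
    [CommRing R] [CommRing S] {f : R →+* S} (hf : Function.Injective f) :
    Function.Injective (Matrix.GeneralLinearGroup.map (n := m) f) := by
  intro A B h
  ext i j
  exact hf (congrArg (fun C : Matrix.GeneralLinearGroup m S => C i j) h)

theorem MonoidHom.map_eq_one_of_mem_derivedSeries_of_finite {K G : Type*} [Field K] [Finite K]
    [Group G] (hG : closure {g : G | IsNilElement g} = ⊤) {n : ℕ}
    (ψ : G →* Matrix.GeneralLinearGroup (Fin n) K) {g : G} (hg : g ∈ derivedSeries G (2 * n)) :
    ψ g = 1 := by
  have hQ : Group.IsNilpotent ψ.range := by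
    have h := isNilpotent_closure_nilElements_of_finite (G := ψ.range)
    suffices htop : closure {g : ψ.range | IsNilElement g} = ⊤ by
      rw [htop] at h
      exact (Group.isNilpotent_congr topEquiv).1 h
    rw [eq_top_iff, ← map_top_of_surjective _ ψ.rangeRestrict_surjective, ← hG,
      MonoidHom.map_closure]
    apply Subgroup.closure_mono
    rintro _ ⟨x, hx, rfl⟩
    exact hx.map _ ψ.rangeRestrict_surjective
  let j : Matrix.GeneralLinearGroup (Fin n) K →*
      Matrix.GeneralLinearGroup (Fin n) (AlgebraicClosure K) :=
    Matrix.GeneralLinearGroup.map (algebraMap K (AlgebraicClosure K))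
  let ρ : ψ.range →* End (AlgebraicClosure K) (Fin n → AlgebraicClosure K) :=
    ((Matrix.toLinAlgEquiv' (R := AlgebraicClosure K) (n := Fin n)).toRingEquiv.toMonoidHom.comp
      (Units.coeHom _)).comp (j.comp ψ.range.subtype)
  have hρ : Function.Injective ρ := by
    refine (Matrix.toLinAlgEquiv'.injective.comp Units.val_injective).comp
      (Function.Injective.comp (g := j) ?_ ψ.range.subtype_injective)
    exact Matrix.GeneralLinearGroup.map_injective (algebraMap K (AlgebraicClosure K)).injective
  have h1 := ρ.map_eq_one_of_mem_derivedSeries_of_isNilpotent n ψ.range _ (by simp)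
    (ψ.rangeRestrict g) (map_derivedSeries_le_derivedSeries ψ.rangeRestrict _
      (mem_map_of_mem _ hg))
  exact congrArg Subtype.val (hρ (h1.trans (map_one ρ).symm))

theorem MonoidHom.map_eq_one_of_mem_derivedSeries_of_finiteType {R G : Type*} [CommRing R]
    [IsDomain R] [Algebra.FiniteType ℤ R]
    [Group G] (hG : closure {g : G | IsNilElement g} = ⊤) {n : ℕ}
    (ψ : G →* Matrix.GeneralLinearGroup (Fin n) R) {g : G} (hg : g ∈ derivedSeries G (2 * n)) :
    ψ g = 1 := by
  have := isJacobsonRing_int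
  have hR : IsJacobsonRing R := isJacobsonRing_of_finiteType (A := ℤ)
  have hbot : (⊥ : Ideal R).jacobson = ⊥ :=
    isJacobsonRing_iff_prime_eq.1 hR ⊥ Ideal.isPrime_bot
  ext i j
  rw [← sub_eq_zero, ← Ideal.mem_bot, ← hbot, Ideal.jacobson, Ideal.mem_sInf]
  rintro m ⟨-, hm⟩
  have hft : Algebra.FiniteType ℤ (R ⧸ m) :=
    Algebra.FiniteType.of_surjective (Ideal.Quotient.mkₐ ℤ m) (Ideal.Quotient.mkₐ_surjective ℤ m)
  let := Ideal.Quotient.field m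
  have := @finite_of_field_of_finiteType_int (R ⧸ m) _ hft
  have h := ((Matrix.GeneralLinearGroup.map (Ideal.Quotient.mk m)).comp
    ψ).map_eq_one_of_mem_derivedSeries_of_finite hG hg
  rw [← Ideal.Quotient.eq_zero_iff_mem, map_sub, sub_eq_zero]
  have hij := congrArg (fun A : Matrix.GeneralLinearGroup (Fin n) (R ⧸ m) => A i j) h
  simpa [Matrix.one_apply, apply_ite (Ideal.Quotient.mk m)] using hij

/-- A finitely generated linear group is defined over a finitely generated ring. -/
theorem MonoidHom.exists_lift_generalLinearGroup {P G : Type*} [Field P] [Group G] {n : ℕ}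
    (φ : G →* Matrix.GeneralLinearGroup (Fin n) P) {S : Set G} (hfin : S.Finite)
    (hS : closure S = ⊤) :
    ∃ R : Subalgebra ℤ P, R.FG ∧ ∃ ψ : G →* Matrix.GeneralLinearGroup (Fin n) R,
      (Matrix.GeneralLinearGroup.map (algebraMap R P)).comp ψ = φ := by
  classical
  let T : Set P := ⋃ s ∈ S, ⋃ i, ⋃ j, {(φ s) i j, (φ s)⁻¹ i j}
  have hT : T.Finite :=
    hfin.biUnion fun s _ => Set.finite_iUnion fun i => Set.finite_iUnion fun j =>
      Set.toFinite _
  have hmem : ∀ s ∈ S, ∀ i j, (φ s) i j ∈ Algebra.adjoin ℤ T ∧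
      (φ s)⁻¹ i j ∈ Algebra.adjoin ℤ T := by
    intro s hs i j
    constructor <;> apply Algebra.subset_adjoin <;>
      exact Set.mem_biUnion hs (Set.mem_iUnion.2 ⟨i, Set.mem_iUnion.2 ⟨j, by simp⟩⟩)
  refine ⟨Algebra.adjoin ℤ T, Subalgebra.fg_def.2 ⟨T, hT, rfl⟩, ?_⟩
  generalize Algebra.adjoin ℤ T = R at hmem
  have hinj : Function.Injective (Matrix.GeneralLinearGroup.map (n := Fin n) (algebraMap R P)) :=
    Matrix.GeneralLinearGroup.map_injective Subtype.val_injective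
  have hrange : ∀ g, φ g ∈ (Matrix.GeneralLinearGroup.map (n := Fin n) (algebraMap R P)).range := by
    intro g
    have hle : closure S ≤
        (Matrix.GeneralLinearGroup.map (n := Fin n) (algebraMap R P)).range.comap φ := by
      rw [closure_le]
      intro s hs
      let A : Matrix (Fin n) (Fin n) R := fun i j => ⟨_, (hmem s hs i j).1⟩
      let B : Matrix (Fin n) (Fin n) R := fun i j => ⟨_, (hmem s hs i j).2⟩
      have hA : A.map (algebraMap R P) = φ s := rfl
      have hB : B.map (algebraMap R P) = (φ s)⁻¹ := rfl
      have hi : Function.Injective fun M : Matrix (Fin n) (Fin n) R => M.map (algebraMap R P) :=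
        Matrix.map_injective Subtype.val_injective
      refine ⟨⟨A, B, hi ?_, hi ?_⟩, ?_⟩
      · simp [Matrix.map_mul, hA, hB, Matrix.map_one _ (map_zero _) (map_one _)]
      · simp [Matrix.map_mul, hA, hB, Matrix.map_one _ (map_zero _) (map_one _)]
      · ext i j
        rfl
    exact hle (hS ▸ mem_top g)
  refine ⟨(MonoidHom.ofInjective hinj).symm.toMonoidHom.comp (φ.codRestrict _ hrange), ?_⟩
  ext1 g
  exact congrArg Subtype.val ((MonoidHom.ofInjective hinj).apply_symm_apply
    (φ.codRestrict _ hrange g))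

theorem derivedSeries_eq_bot_of_closure_nilElements {P G : Type*} [Field P] [Group G] {n : ℕ}
    (φ : G →* Matrix.GeneralLinearGroup (Fin n) P) (hφ : Function.Injective φ) {S : Set G}
    (hfin : S.Finite) (hS : closure S = ⊤) (hnil : ∀ s ∈ S, IsNilElement s) :
    derivedSeries G (2 * n) = ⊥ := by
  obtain ⟨R, hR, ψ, hψ⟩ := φ.exists_lift_generalLinearGroup hfin hS
  have : Algebra.FiniteType ℤ R := R.fg_iff_finiteType.1 hR
  have htop : closure {g : G | IsNilElement g} = ⊤ := by
    rw [eq_top_iff, ← hS]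
    exact Subgroup.closure_mono hnil
  rw [eq_bot_iff]
  intro g hg
  rw [mem_bot]
  apply hφ
  rw [← hψ, MonoidHom.comp_apply, ψ.map_eq_one_of_mem_derivedSeries_of_finiteType htop hg,
    map_one, map_one]

end Residual

section NilpotentAction

open Subgroup
open scoped commutatorElement

variable {Γ : Type*} [Group Γ]

section FixedSeries

variable (M : Type*) [CommGroup M] [MulDistribMulAction Γ M]

/-- The ascending series of iterated fixed points of a set of operators on an abelian group. -/
def fixedSeries (X : Set Γ) : ℕ → Subgroup M
  | 0 => ⊥
  | i + 1 =>
    { carrier := {m | ∀ x ∈ X, x • m / m ∈ fixedSeries X i}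
      one_mem' := fun x _ => by simp
      mul_mem' := fun {a b} ha hb x hx => by
        rw [smul_mul', mul_div_mul_comm]
        exact mul_mem (ha x hx) (hb x hx)
      inv_mem' := fun {a} ha x hx => by
        rw [smul_inv', inv_div_inv, ← inv_div]
        exact inv_mem (ha x hx) }

/-- A set of operators acts nilpotently if its iterated fixed points exhaust the group. -/
def ActsNilpotently (X : Set Γ) : Prop :=
  ∀ m : M, ∃ k, m ∈ fixedSeries M X k

variable {M}

theorem mem_fixedSeries_zero {X : Set Γ} {m : M} : m ∈ fixedSeries M X 0 ↔ m = 1 :=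
  Subgroup.mem_bot

theorem mem_fixedSeries_succ {X : Set Γ} {i : ℕ} {m : M} :
    m ∈ fixedSeries M X (i + 1) ↔ ∀ x ∈ X, x • m / m ∈ fixedSeries M X i :=
  Iff.rfl

theorem fixedSeries_anti {X Y : Set Γ} (h : X ⊆ Y) (i : ℕ) :
    fixedSeries M Y i ≤ fixedSeries M X i := by
  induction i with
  | zero => exact le_rfl
  | succ i ih => exact fun m hm x hx => ih (hm x (h hx))

theorem smul_mem_fixedSeries {X : Set Γ} {g : Γ} (hg : ∀ x ∈ X, g⁻¹ * x * g ∈ X) {i : ℕ} {m : M}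
    (hm : m ∈ fixedSeries M X i) : g • m ∈ fixedSeries M X i := by
  induction i generalizing m with
  | zero => rw [mem_fixedSeries_zero.1 hm, smul_one]; exact one_mem _
  | succ i ih =>
    intro x hx
    have : x • g • m / g • m = g • ((g⁻¹ * x * g) • m / m) := by
      simp [smul_div', mul_smul]
    rw [this]
    exact ih (hm _ (hg x hx))

theorem fixedSeries_closure (X : Set Γ) (i : ℕ) :
    fixedSeries M (closure X : Set Γ) i = fixedSeries M X i := by
  refine le_antisymm (fixedSeries_anti Subgroup.subset_closure i) ?_
  induction i with
  | zero => exact le_rfl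
  | succ i ih =>
    have ih : fixedSeries M (closure X : Set Γ) i = fixedSeries M X i :=
      le_antisymm (fixedSeries_anti Subgroup.subset_closure i) ih
    have hinv : ∀ g ∈ closure X, ∀ m ∈ fixedSeries M X i, g • m ∈ fixedSeries M X i := by
      intro g hg m hm
      rw [← ih] at hm ⊢
      exact smul_mem_fixedSeries (fun x hx => mul_mem (mul_mem (inv_mem hg) hx) hg) hm
    intro m hm x hx
    rw [ih]
    induction hx using closure_induction with
    | mem x hx => exact hm x hx
    | one => simp
    | mul x y hx hy ihx ihy =>
      have : (x * y) • m / m = x • (y • m / m) * (x • m / m) := by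
        simp [smul_div', mul_smul]
      rw [this]
      exact mul_mem (hinv x hx _ ihy) ihx
    | inv x hx ihx =>
      have : x⁻¹ • m / m = (x⁻¹ • (x • m / m))⁻¹ := by simp [smul_div']
      rw [this]
      exact inv_mem (hinv _ (inv_mem hx) _ ihx)

theorem mem_fixedSeries_sup {N₁ N₂ : Subgroup Γ} (h₁ : ∀ x ∈ N₁, ∀ y ∈ N₂, y * x * y⁻¹ ∈ N₁)
    (h₂ : ∀ x ∈ N₂, ∀ y ∈ N₁, y * x * y⁻¹ ∈ N₂) {k l : ℕ} {m : M}
    (hk : m ∈ fixedSeries M (N₁ : Set Γ) k) (hl : m ∈ fixedSeries M (N₂ : Set Γ) l) :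
    m ∈ fixedSeries M ((N₁ ⊔ N₂ : Subgroup Γ) : Set Γ) (k + l) := by
  rw [sup_eq_closure, fixedSeries_closure]
  induction hn : k + l generalizing k l m with
  | zero =>
    obtain rfl : k = 0 := by omega
    exact hk
  | succ n ih =>
    cases k with
    | zero => rw [mem_fixedSeries_zero.1 hk]; exact one_mem _
    | succ k =>
      cases l with
      | zero => rw [mem_fixedSeries_zero.1 hl]; exact one_mem _
      | succ l =>
        rintro x (hx | hx)
        · refine ih (hk x hx) (div_mem (smul_mem_fixedSeries (fun y hy => ?_) hl) hl) (by omega)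
          simpa using h₂ y hy _ (inv_mem hx)
        · refine ih (div_mem (smul_mem_fixedSeries (fun y hy => ?_) hk) hk) (hl x hx) (by omega)
          simpa using h₁ y hy _ (inv_mem hx)

namespace ActsNilpotently

theorem mono {X Y : Set Γ} (hY : ActsNilpotently M Y) (h : X ⊆ Y) : ActsNilpotently M X :=
  fun m => (hY m).imp fun k hk => fixedSeries_anti h k hk

theorem closure_iff {X : Set Γ} : ActsNilpotently M (closure X : Set Γ) ↔ ActsNilpotently M X := by
  simp only [ActsNilpotently, fixedSeries_closure]

theorem conj_singleton {t : Γ} (ht : ActsNilpotently M {t}) (g : Γ) :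
    ActsNilpotently M {g * t * g⁻¹} := by
  have key : ∀ k, ∀ m : M, m ∈ fixedSeries M {t} k → g • m ∈ fixedSeries M {g * t * g⁻¹} k := by
    intro k
    induction k with
    | zero => intro m hm; rw [mem_fixedSeries_zero.1 hm, smul_one]; exact one_mem _
    | succ k ih =>
      rintro m hm _ rfl
      have : (g * t * g⁻¹) • g • m / g • m = g • (t • m / m) := by simp [smul_div', mul_smul]
      rw [this]
      exact ih _ (hm t rfl)
  intro m
  obtain ⟨k, hk⟩ := ht (g⁻¹ • m)
  exact ⟨k, by simpa using key k _ hk⟩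

theorem of_normalized {T : Set Γ} (hT : T.Finite) (N : Γ → Subgroup Γ)
    (hself : ∀ t ∈ T, t ∈ N t) (hle : ∀ t ∈ T, N t ≤ closure T)
    (hconj : ∀ t ∈ T, ∀ g ∈ closure T, (N t).map (MulAut.conj g).toMonoidHom ≤ N t)
    (hN : ∀ t ∈ T, ActsNilpotently M (N t : Set Γ)) : ActsNilpotently M T := by
  suffices h : ∃ K : Subgroup Γ, T ⊆ K ∧ K ≤ closure T ∧
      (∀ g ∈ closure T, K.map (MulAut.conj g).toMonoidHom ≤ K) ∧
      ActsNilpotently M (K : Set Γ) by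
    obtain ⟨K, hTK, -, -, hK⟩ := h
    exact hK.mono hTK
  generalize hH : closure T = H at hle hconj
  clear hH
  induction T, hT using Set.Finite.induction_on with
  | empty => exact ⟨⊥, by simp, bot_le, by simp, fun m => ⟨1, by simp [mem_fixedSeries_succ]⟩⟩
  | insert _ _ ih =>
    rename_i t T _ _
    obtain ⟨K, hTK, hKH, hKc, hK⟩ := ih (fun t ht => hself t (.inr ht))
      (fun t ht => hN t (.inr ht)) (fun t ht => hle t (.inr ht)) (fun t ht => hconj t (.inr ht))
    have htT : t ∈ insert t T := Set.mem_insert t T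
    refine ⟨N t ⊔ K, ?_, sup_le (hle t htT) hKH, ?_, ?_⟩
    · rintro x (rfl | hx)
      · exact mem_sup_left (hself x htT)
      · exact mem_sup_right (hTK hx)
    · intro g hg
      rw [Subgroup.map_sup]
      exact sup_le_sup (hconj t htT g hg) (hKc g hg)
    · intro m
      obtain ⟨k, hk⟩ := hN t htT m
      obtain ⟨l, hl⟩ := hK m
      refine ⟨k + l, mem_fixedSeries_sup ?_ ?_ hk hl⟩
      · exact fun x hx y hy => hconj t htT y (hKH hy) (mem_map_of_mem _ hx)
      · exact fun x hx y hy => hKc y (hle t htT hy) (mem_map_of_mem _ hx)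

end ActsNilpotently

end FixedSeries

namespace Subgroup

theorem exists_finite_subset_of_subset_closure {E C : Set Γ} (hE : E.Finite)
    (h : E ⊆ closure C) : ∃ T ⊆ C, T.Finite ∧ E ⊆ closure T := by
  have key : ∀ x ∈ closure C, ∃ T ⊆ C, T.Finite ∧ x ∈ closure T := by
    intro x hx
    induction hx using closure_induction with
    | mem x hx =>
      exact ⟨{x}, Set.singleton_subset_iff.2 hx, Set.finite_singleton x,
        Subgroup.subset_closure rfl⟩
    | one => exact ⟨∅, Set.empty_subset _, Set.finite_empty, one_mem _⟩
    | mul x y _ _ ihx ihy =>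
      obtain ⟨T₁, h₁, hf₁, hx⟩ := ihx
      obtain ⟨T₂, h₂, hf₂, hy⟩ := ihy
      exact ⟨T₁ ∪ T₂, Set.union_subset h₁ h₂, hf₁.union hf₂,
        mul_mem (Subgroup.closure_mono Set.subset_union_left hx)
          (Subgroup.closure_mono Set.subset_union_right hy)⟩
    | inv x _ ihx =>
      obtain ⟨T, hT, hf, hx⟩ := ihx
      exact ⟨T, hT, hf, inv_mem hx⟩
  choose! T hTC hTf hT using key
  exact ⟨⋃ x ∈ E, T x, Set.iUnion₂_subset fun x hx => hTC x (h hx),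
    hE.biUnion fun x hx => hTf x (h hx),
    fun x hx => Subgroup.closure_mono (Set.subset_biUnion_of_mem hx) (hT x (h hx))⟩

/-- The sets of left-normed commutators with first entry in `X` and the others in `S`. -/
def leftNormedCommutators (X S : Set Γ) : ℕ → Set Γ
  | 0 => X
  | j + 1 => Set.image2 (fun x y => ⁅x, y⁆) (leftNormedCommutators X S j) S

theorem finite_leftNormedCommutators {X S : Set Γ} (hX : X.Finite) (hS : S.Finite) (j : ℕ) :
    (leftNormedCommutators X S j).Finite := by
  induction j with
  | zero => exact hX
  | succ j ih => exact ih.image2 _ hS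

theorem leftNormedCommutators_subset_lowerCentralSeries {X S : Set Γ} {N : Subgroup Γ}
    (hX : X ⊆ N) (hS : S ⊆ N) (j : ℕ) : leftNormedCommutators X S j ⊆ N.lowerCentralSeries j := by
  induction j with
  | zero => exact hX
  | succ j ih =>
    rintro _ ⟨x, hx, y, hy, rfl⟩
    exact commutator_mem_commutator (ih hx) (hS hy)

theorem commutator_closure_le {X Y : Set Γ} {K N : Subgroup Γ} (hX : X ⊆ N) (hY : Y ⊆ N)
    (hK : ∀ g ∈ N, ∀ x ∈ K, g * x * g⁻¹ ∈ K) (h : ∀ x ∈ X, ∀ y ∈ Y, ⁅x, y⁆ ∈ K) :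
    ⁅closure X, closure Y⁆ ≤ K := by
  have key : ∀ {X : Set Γ} {y : Γ}, X ⊆ N → (∀ x ∈ X, ⁅x, y⁆ ∈ K) →
      ∀ x ∈ closure X, ⁅x, y⁆ ∈ K := by
    intro X y hX h x hx
    induction hx using closure_induction with
    | mem x hx => exact h x hx
    | one => simp
    | mul a b ha hb iha ihb =>
      have : ⁅a * b, y⁆ = a * ⁅b, y⁆ * a⁻¹ * ⁅a, y⁆ := by
        simp [commutatorElement_def, mul_assoc]
      rw [this]
      exact mul_mem (hK a ((Subgroup.closure_le N).2 hX ha) _ ihb) iha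
    | inv a ha iha =>
      have : ⁅a⁻¹, y⁆ = a⁻¹ * ⁅a, y⁆⁻¹ * a⁻¹⁻¹ := by
        simp [commutatorElement_def, mul_assoc]
      rw [this]
      exact hK _ (inv_mem ((Subgroup.closure_le N).2 hX ha)) _ (inv_mem iha)
  rw [commutator_le]
  intro x hx y hy
  rw [← inv_mem_iff, commutatorElement_inv]
  refine key hY (fun y hy => ?_) y hy
  rw [← inv_mem_iff, commutatorElement_inv]
  exact key hX (fun x hx => h x hx y hy) x hx

theorem conj_mem_lowerCentralSeries {N : Subgroup Γ} {i : ℕ} {g x : Γ} (hg : g ∈ N)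
    (hx : x ∈ N.lowerCentralSeries i) : g * x * g⁻¹ ∈ N.lowerCentralSeries i :=
  (mem_normalizer_iff.1 (N.self_le_normalizer_lowerCentralSeries i hg) x).1 hx

theorem lowerCentralSeries_closure_conj_le {N : Subgroup Γ} {t : Γ} (ht : t ∈ N) (i : ℕ) :
    (closure ((fun g => g * t * g⁻¹) '' (N : Set Γ))).lowerCentralSeries (i + 1) ≤
      N.lowerCentralSeries (i + 2) := by
  have hsub : (fun g => g * t * g⁻¹) '' (N : Set Γ) ⊆ N := by
    rintro _ ⟨g, hg, rfl⟩
    exact mul_mem (mul_mem hg ht) (inv_mem hg)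
  induction i with
  | zero =>
    refine commutator_closure_le hsub hsub (fun g hg x hx => conj_mem_lowerCentralSeries hg hx) ?_
    rintro _ ⟨a, ha, rfl⟩ _ ⟨b, hb, rfl⟩
    have : ⁅a * t * a⁻¹, b * t * b⁻¹⁆ = b * ⁅⁅b⁻¹ * a, t⁆, t⁆ * b⁻¹ := by
      simp [commutatorElement_def, mul_assoc]
    rw [this]
    refine conj_mem_lowerCentralSeries hb (commutator_mem_commutator ?_ ht)
    exact commutator_mem_commutator (mul_mem (inv_mem hb) ha) ht
  | succ i ih => exact commutator_mono ih ((Subgroup.closure_le N).2 hsub)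

/-- In a finitely generated nilpotent group, normal closures of elements are generated by
finitely many conjugates. -/
theorem exists_finite_closure_eq_closure_conj {S : Set Γ} (hS : S.Finite) {c : ℕ}
    (hc : (closure S).lowerCentralSeries c = ⊥) {t : Γ} (ht : t ∈ closure S) :
    ∃ T ⊆ (fun g => g * t * g⁻¹) '' (closure S : Set Γ), T.Finite ∧
      closure T = closure ((fun g => g * t * g⁻¹) '' (closure S : Set Γ)) := by
  set C := (fun g => g * t * g⁻¹) '' (closure S : Set Γ)
  set S' := S ∪ S⁻¹
  have hS'c : S' ⊆ closure S := by
    rintro x (hx | hx)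
    · exact Subgroup.subset_closure hx
    · exact inv_mem_iff.1 (Subgroup.subset_closure hx)
  let F := leftNormedCommutators {t} S'
  let E := ⋃ j ∈ Set.Iic c, F j
  have hE : E.Finite := (Set.finite_Iic c).biUnion fun j _ =>
    finite_leftNormedCommutators (Set.finite_singleton t) (hS.union hS.inv) j
  have hCconj : ∀ g ∈ closure S, ∀ x ∈ closure C, g * x * g⁻¹ ∈ closure C := by
    intro g hg x hx
    have hle : (closure C).map (MulAut.conj g).toMonoidHom ≤ closure C := by
      rw [MonoidHom.map_closure]
      apply Subgroup.closure_mono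
      rintro _ ⟨_, ⟨a, ha, rfl⟩, rfl⟩
      exact ⟨g * a, mul_mem hg ha, by simp [mul_assoc]⟩
    exact hle (mem_map_of_mem _ hx)
  have hFC : ∀ j, F j ⊆ closure C := by
    intro j
    induction j with
    | zero =>
      rintro x (hx : x = t)
      rw [hx]
      exact Subgroup.subset_closure ⟨1, one_mem _, by simp⟩
    | succ j ih =>
      rintro _ ⟨x, hx, y, hy, rfl⟩
      have : ⁅x, y⁆ = x * (y * x⁻¹ * y⁻¹) := by simp [commutatorElement_def, mul_assoc]
      change ⁅x, y⁆ ∈ closure C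
      rw [this]
      exact mul_mem (ih hx) (hCconj y (hS'c hy) _ (inv_mem (ih hx)))
  have hEconj : ∀ s ∈ S', ∀ x ∈ closure E, s * x * s⁻¹ ∈ closure E := by
    intro s hs x hx
    have hle : (closure E).map (MulAut.conj s).toMonoidHom ≤ closure E := by
      rw [MonoidHom.map_closure, Subgroup.closure_le]
      rintro _ ⟨x, hx, rfl⟩
      have hxE : x ∈ closure E := Subgroup.subset_closure hx
      obtain ⟨j, hj, hxj⟩ := Set.mem_iUnion₂.1 hx
      have : MulAut.conj s x = ⁅x, s⁆⁻¹ * x := by simp [commutatorElement_def, mul_assoc]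
      change MulAut.conj s x ∈ closure E
      rw [this]
      refine mul_mem (inv_mem ?_) hxE
      rcases (Set.mem_Iic.1 hj).lt_or_eq with hjc | hjc
      · exact Subgroup.subset_closure (Set.mem_biUnion (Set.mem_Iic.2 hjc) ⟨x, hxj, s, hs, rfl⟩)
      · have hx1 := leftNormedCommutators_subset_lowerCentralSeries
          (Set.singleton_subset_iff.2 ht) hS'c _ hxj
        rw [hjc, hc] at hx1
        rw [mem_bot.1 hx1, commutatorElement_one_left]
        exact one_mem _
    exact hle (mem_map_of_mem _ hx)
  have hnorm : closure S ≤ normalizer (closure E : Set Γ) := by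
    rw [Subgroup.closure_le]
    intro s hs
    rw [SetLike.mem_coe, mem_normalizer_iff]
    refine fun x => ⟨hEconj s (.inl hs) x, fun hx => ?_⟩
    simpa [mul_assoc] using hEconj s⁻¹ (.inr (Set.inv_mem_inv.2 hs)) _ hx
  have hCE : C ⊆ closure E := by
    rintro _ ⟨g, hg, rfl⟩
    exact (mem_normalizer_iff.1 (hnorm hg) t).1
      (Subgroup.subset_closure (Set.mem_biUnion (Set.mem_Iic.2 c.zero_le) rfl))
  obtain ⟨T, hTC, hTf, hET⟩ := exists_finite_subset_of_subset_closure hE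
    (Set.iUnion₂_subset fun j _ => hFC j)
  refine ⟨T, hTC, hTf, le_antisymm (Subgroup.closure_mono hTC) ?_⟩
  rw [Subgroup.closure_le]
  exact hCE.trans ((Subgroup.closure_le _).2 hET)

end Subgroup

theorem ActsNilpotently.of_lowerCentralSeries_eq_bot {M : Type*} [CommGroup M]
    [MulDistribMulAction Γ M] {T : Set Γ} (hT : T.Finite) {c : ℕ}
    (hc : (closure T).lowerCentralSeries (c + 1) = ⊥)
    (h : ∀ t ∈ T, ActsNilpotently M {t}) : ActsNilpotently M T := by
  induction c generalizing T with
  | zero =>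
    refine ActsNilpotently.of_normalized hT (fun t => closure {t})
      (fun t _ => Subgroup.subset_closure rfl)
      (fun t ht => Subgroup.closure_mono (Set.singleton_subset_iff.2 ht)) ?_
      (fun t ht => ActsNilpotently.closure_iff.2 (h t ht))
    intro t ht g hg
    rw [MonoidHom.map_closure, Set.image_singleton, Subgroup.closure_le, Set.singleton_subset_iff]
    have hcomm : ⁅g, t⁆ ∈ (closure T).lowerCentralSeries (0 + 1) :=
      commutator_mem_commutator hg (Subgroup.subset_closure ht)
    rw [hc, mem_bot, commutatorElement_eq_one_iff_mul_comm] at hcomm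
    have : (MulAut.conj g).toMonoidHom t = t := by simp [hcomm]
    rw [this]
    exact Subgroup.subset_closure rfl
  | succ c ih =>
    refine ActsNilpotently.of_normalized hT
      (fun t => closure ((fun g => g * t * g⁻¹) '' (closure T : Set Γ)))
      (fun t _ => Subgroup.subset_closure ⟨1, one_mem _, by simp⟩) ?_ ?_ ?_
    · intro t ht
      rw [Subgroup.closure_le]
      rintro _ ⟨g, hg, rfl⟩
      exact mul_mem (mul_mem hg (Subgroup.subset_closure ht)) (inv_mem hg)
    · intro t _ g hg
      rw [MonoidHom.map_closure]
      apply Subgroup.closure_mono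
      rintro _ ⟨_, ⟨a, ha, rfl⟩, rfl⟩
      exact ⟨g * a, mul_mem hg ha, by simp [mul_assoc]⟩
    · intro t ht
      have htT : t ∈ closure T := Subgroup.subset_closure ht
      obtain ⟨T', hT'C, hT'f, hT'⟩ := exists_finite_closure_eq_closure_conj hT hc htT
      rw [← hT', ActsNilpotently.closure_iff]
      refine ih hT'f ?_ ?_
      · rw [hT', eq_bot_iff, ← hc]
        exact lowerCentralSeries_closure_conj_le htT c
      · intro x hx
        obtain ⟨g, -, rfl⟩ := hT'C hx
        exact (h t ht).conj_singleton g

end NilpotentAction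

section NilElements

open Subgroup
open scoped commutatorElement IsMulCommutative

variable {G : Type*} [Group G]

theorem engelWord_succ_left (n : ℕ) (x y : G) :
    engelWord (n + 1) x y = engelWord n (engelWord 1 x y) y := by
  induction n with
  | zero => rfl
  | succ n ih => rw [engelWord, ih, ← engelWord]

theorem IsNilElement.actsNilpotently_conjNormal {A : Subgroup G} [A.Normal] [IsMulCommutative A]
    {t : G} (ht : IsNilElement t) :
    ActsNilpotently A {(MulAut.conjNormal t⁻¹ : MulAut A)} := by
  have key : ∀ n, ∀ a : A, engelWord n (a : G) t = 1 →
      a ∈ fixedSeries A {(MulAut.conjNormal t⁻¹ : MulAut A)} n := by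
    intro n
    induction n with
    | zero => exact fun a ha => mem_fixedSeries_zero.2 (Subtype.ext ha)
    | succ n ih =>
      rintro a ha _ rfl
      apply ih
      rw [← ha, engelWord_succ_left]
      congr 1
      rw [div_eq_mul_inv, mul_comm]
      simp [engelWord, mul_assoc]
  intro a
  obtain ⟨n, hn⟩ := ht.exists_engelWord_eq_one (a : G)
  exact ⟨n, key n a hn⟩

theorem mem_upperCentralSeries_of_mem_fixedSeries {A : Subgroup G} [A.Normal] [IsMulCommutative A]
    {S : Set G} (hS : closure S = ⊤) {k : ℕ} {a : A}
    (ha : a ∈ fixedSeries A ((fun s => (MulAut.conjNormal s⁻¹ : MulAut A)) '' S) k) :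
    (a : G) ∈ Subgroup.upperCentralSeries G k := by
  induction k generalizing a with
  | zero =>
    rw [mem_fixedSeries_zero.1 ha]
    exact one_mem _
  | succ k ih =>
    have hS' : closure S⁻¹ = ⊤ := by rw [Subgroup.closure_inv, hS]
    refine Subgroup.mem_upperCentralSeries_succ_of_closure hS' fun x hx => ?_
    have h := ih (ha _ ⟨x⁻¹, hx, rfl⟩)
    have : ⁅(a : G), x⁆ = ((MulAut.conjNormal x⁻¹⁻¹ : MulAut A) • a / a : A)⁻¹ := by
      rw [inv_div]
      simp [commutatorElement_def, div_eq_mul_inv, mul_assoc]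
    rw [this, InvMemClass.coe_inv]
    exact inv_mem h

/-- A group generated by finitely many nil-elements which is an extension of an abelian group
by a nilpotent group is nilpotent. -/
theorem Group.IsNilpotent.of_closure_nilElements_of_quotient {A : Subgroup G} [A.Normal]
    [IsMulCommutative A] (hQ : Group.IsNilpotent (G ⧸ A)) {S : Set G} (hfin : S.Finite)
    (hS : closure S = ⊤) (hnil : ∀ s ∈ S, IsNilElement s) : Group.IsNilpotent G := by
  obtain ⟨c, hc⟩ := Subgroup.nilpotent_iff_lowerCentralSeries.1 hQ
  have hcA : (⊤ : Subgroup G).lowerCentralSeries c ≤ A := by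
    intro x hx
    have h := mem_map_of_mem (QuotientGroup.mk' A) hx
    rw [map_lowerCentralSeries] at h
    have h' : QuotientGroup.mk' A x ∈ (⊤ : Subgroup (G ⧸ A)).lowerCentralSeries c :=
      lowerCentralSeries_mono c le_top h
    rw [hc, mem_bot] at h'
    exact (QuotientGroup.eq_one_iff x).1 h'
  let T := (fun s => (MulAut.conjNormal s⁻¹ : MulAut A)) '' S
  have hT : (closure T).lowerCentralSeries (c + 1) = ⊥ := by
    rw [eq_bot_iff]
    have hle : closure T ≤ (⊤ : Subgroup G).map (MulAut.conjNormal (H := A)) := by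
      rw [Subgroup.closure_le]
      rintro _ ⟨s, -, rfl⟩
      exact mem_map_of_mem _ (mem_top _)
    refine (Subgroup.lowerCentralSeries_antitone _ c.le_succ).trans
      ((lowerCentralSeries_mono c hle).trans ?_)
    beta_reduce
    rw [← map_lowerCentralSeries]
    rintro _ ⟨x, hx, rfl⟩
    rw [mem_bot]
    ext a
    have := mul_comm (⟨x, hcA hx⟩ : A) a
    have h := congrArg Subtype.val this
    simp only [coe_mul] at h
    simp [h]
  have hact : ActsNilpotently A T := by
    refine ActsNilpotently.of_lowerCentralSeries_eq_bot (hfin.image _) hT ?_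
    rintro _ ⟨s, hs, rfl⟩
    exact (hnil s hs).actsNilpotently_conjNormal
  let F := leftNormedCommutators S S
  have hF : ∀ j, (F j).Finite := finite_leftNormedCommutators hfin hfin
  have hFA : F c ⊆ A := (leftNormedCommutators_subset_lowerCentralSeries (N := ⊤)
    (fun _ _ => mem_top _) (fun _ _ => mem_top _) c).trans hcA
  have hex : ∀ x ∈ F c, ∃ k, x ∈ Subgroup.upperCentralSeries G k := fun x hx =>
    (hact ⟨x, hFA hx⟩).imp fun _ hk => mem_upperCentralSeries_of_mem_fixedSeries hS hk
  choose! k hk using hex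
  obtain ⟨K, hK⟩ := ((hF c).image k).bddAbove
  have hdesc : ∀ j ≤ c, F (c - j) ⊆ Subgroup.upperCentralSeries G (K + j) := by
    intro j hj
    induction j with
    | zero => exact fun x hx =>
        Subgroup.upperCentralSeries_mono G (hK (Set.mem_image_of_mem k hx)) (hk x hx)
    | succ j ih =>
      intro x hx
      refine Subgroup.mem_upperCentralSeries_succ_of_closure hS fun s hs => ih (by omega) ?_
      rw [show c - j = c - (j + 1) + 1 by omega]
      exact ⟨x, hx, s, hs, rfl⟩
  have h0 := hdesc c le_rfl
  rw [Nat.sub_self] at h0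
  refine ⟨K + c, ?_⟩
  rw [eq_top_iff, ← hS, Subgroup.closure_le]
  exact h0

/-- **Gruenberg's theorem** for solvable groups generated by finitely many nil-elements. -/
theorem Group.IsNilpotent.of_closure_nilElements_of_derivedSeries {d : ℕ}
    (hd : derivedSeries G d = ⊥) {S : Set G} (hfin : S.Finite) (hS : closure S = ⊤)
    (hnil : ∀ s ∈ S, IsNilElement s) : Group.IsNilpotent G := by
  induction d generalizing G with
  | zero =>
    rw [derivedSeries_zero] at hd
    exact ⟨0, by rw [Subgroup.upperCentralSeries_zero, hd]⟩
  | succ d ih =>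
    let A := derivedSeries G d
    have hA : IsMulCommutative A := by
      rw [derivedSeries_succ, commutator_eq_bot_iff_le_centralizer] at hd
      exact ⟨⟨fun a b => Subtype.ext (mem_centralizer_iff.1 (hd b.2) a a.2)⟩⟩
    have hAn : A.Normal := derivedSeries_normal G d
    have hsurj := QuotientGroup.mk'_surjective A
    refine Group.IsNilpotent.of_closure_nilElements_of_quotient (A := A) ?_ hfin hS hnil
    refine ih ?_ (hfin.image (QuotientGroup.mk' A)) ?_ ?_
    · rw [← map_derivedSeries_eq hsurj, Subgroup.map_eq_bot_iff, QuotientGroup.ker_mk']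
    · rw [← MonoidHom.map_closure, hS, map_top_of_surjective _ hsurj]
    · rintro _ ⟨s, hs, rfl⟩
      exact (hnil s hs).map _ hsurj

theorem closure_nilElements_normal : (closure {g : G | IsNilElement g}).Normal := by
  suffices h : normalClosure {g : G | IsNilElement g} = closure {g : G | IsNilElement g} from
    h ▸ normalClosure_normal
  refine le_antisymm ((Subgroup.closure_le _).2 ?_) closure_le_normalClosure
  intro x hx
  obtain ⟨t, ht, hc⟩ := Group.mem_conjugatesOfSet_iff.1 hx
  obtain ⟨g, rfl⟩ := isConj_iff.1 hc
  exact Subgroup.subset_closure (IsNilElement.conj ht g)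

theorem isNilpotent_closure_of_finite_nilElements {P : Type*} [Field P] {n : ℕ}
    (φ : G →* Matrix.GeneralLinearGroup (Fin n) P) (hφ : Function.Injective φ) {S : Set G}
    (hfin : S.Finite) (hnil : ∀ s ∈ S, IsNilElement s) : Group.IsNilpotent (closure S) := by
  have htop : closure ((closure S).subtype ⁻¹' S) = ⊤ := closure_closure_coe_preimage
  have hfin' : ((closure S).subtype ⁻¹' S).Finite :=
    hfin.preimage (closure S).subtype_injective.injOn
  have hnil' : ∀ s ∈ (closure S).subtype ⁻¹' S, IsNilElement s := fun s hs =>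
    (hnil _ hs).of_map _ (closure S).subtype_injective
  exact Group.IsNilpotent.of_closure_nilElements_of_derivedSeries
    (derivedSeries_eq_bot_of_closure_nilElements (φ.comp (closure S).subtype)
      (hφ.comp (closure S).subtype_injective) hfin' htop hnil') hfin' htop hnil'

theorem locallyNilpotent_closure_nilElements {P : Type*} [Field P] {n : ℕ}
    (φ : G →* Matrix.GeneralLinearGroup (Fin n) P) (hφ : Function.Injective φ) :
    LocallyNilpotent (closure {g : G | IsNilElement g}) := by
  intro K hK
  obtain ⟨E, rfl, hEf⟩ := (Subgroup.fg_iff K).1 hK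
  let j := (closure {g : G | IsNilElement g}).subtype
  have hj : Function.Injective j := subtype_injective _
  obtain ⟨S, hSnil, hSf, hES⟩ := exists_finite_subset_of_subset_closure (hEf.image j)
    (C := {g : G | IsNilElement g}) (by rintro _ ⟨x, -, rfl⟩; exact x.2)
  obtain ⟨c, hc⟩ := (isNilpotent_iff_lowerCentralSeries _).1
    (isNilpotent_closure_of_finite_nilElements φ hφ hSf hSnil)
  have hle : (closure E).map j ≤ closure S := by
    rw [MonoidHom.map_closure, Subgroup.closure_le]
    exact hES
  refine (Group.isNilpotent_congr ((closure E).equivMapOfInjective j hj)).2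
    ((isNilpotent_iff_lowerCentralSeries _).2 ⟨c, ?_⟩)
  rw [eq_bot_iff, ← hc]
  exact lowerCentralSeries_mono c hle

end NilElements

/-- in a subgroup `G` of `GL_n(P)`, `P` a field, the subgroup generated by
all nil-elements is normal and locally nilpotent. -/
theorem closure_nilElements_normal_locallyNilpotent_linear (P : Type*) [Field P]
    (n : ℕ) (hn : 1 ≤ n) (G : Subgroup (Matrix.GeneralLinearGroup (Fin n) P)) :
    (Subgroup.closure {g : G | IsNilElement g}).Normal ∧
      LocallyNilpotent (Subgroup.closure {g : G | IsNilElement g}) :=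
  ⟨closure_nilElements_normal,
    locallyNilpotent_closure_nilElements G.subtype G.subtype_injective⟩
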